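/- arXiv:2509.17714 — 3 statements merged into one kernel-verified Lean document; each statement's English description precedes it below -/
import Mathlib

section
/- Let m and t be positive integers and let T_m ⊆ ℝ³ be the Reeve tetrahedron, i.e. the convex hull of the points (0,0,0), (1,0,0), (0,1,0), (1,1,m). Then the number of points of ℤ³ contained in the dilate t·T_m equals (m/6)t³ + t² + ((12−m)/6)t + 1. -/
open scoped Pointwise BigOperators

/-- `P` is an integral polytope: the convex hull of finitely many points
with integer coordinates. -/
def IsIntegralPolytope {N : ℕ} (P : Set (Fin N → ℝ)) : Prop :=
  ∃ V : Finset (Fin N → ℝ),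
    (∀ v ∈ V, ∀ i, ∃ z : ℤ, v i = (z : ℝ)) ∧
    P = convexHull ℝ (V : Set (Fin N → ℝ))

/-- `latticeCount P t = i(P,t)`: the number of points of `ℤ^N` in the dilate `t • P`. -/
noncomputable def latticeCount {N : ℕ} (P : Set (Fin N → ℝ)) (t : ℕ) : ℕ :=
  Set.ncard {x : Fin N → ℝ | x ∈ (t : ℝ) • P ∧ ∀ i, ∃ z : ℤ, x i = (z : ℝ)}

/-- The Reeve tetrahedron `T_m ⊆ ℝ³`. -/
def reeve (m : ℕ) : Set (Fin 3 → ℝ) :=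
  convexHull ℝ {![0, 0, 0], ![1, 0, 0], ![0, 1, 0], ![1, 1, (m : ℝ)]}

/-- The facet description of the dilated Reeve tetrahedron. -/
theorem mem_smul_reeve_iff {m : ℕ} (hm : 0 < m) {t : ℝ} (ht : 0 < t) (x : Fin 3 → ℝ) :
    x ∈ t • reeve m ↔
      0 ≤ x 2 ∧ x 2 ≤ m * x 0 ∧ x 2 ≤ m * x 1 ∧ m * (x 0 + x 1) ≤ m * t + x 2 := by
  have hm' : (0 : ℝ) < m := by exact_mod_cast hm
  constructor
  · rintro ⟨y, hy, rfl⟩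
    have key : reeve m ⊆ {y : Fin 3 → ℝ | 0 ≤ y 2 ∧ y 2 ≤ m * y 0 ∧ y 2 ≤ m * y 1 ∧
        m * (y 0 + y 1) ≤ m + y 2} := by
      refine convexHull_min ?_ ?_
      · rintro v (rfl | rfl | rfl | rfl) <;> simp
        linarith
      · rintro a ⟨ha0, ha1, ha2, ha3⟩ b ⟨hb0, hb1, hb2, hb3⟩ c d hc hd hcd
        obtain rfl : d = 1 - c := by linarith
        simp only [Set.mem_ofPred_eq, Pi.add_apply, Pi.smul_apply, smul_eq_mul]
        refine ⟨by positivity, ?_, ?_, ?_⟩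
        · linarith [mul_le_mul_of_nonneg_left ha1 hc, mul_le_mul_of_nonneg_left hb1 hd]
        · linarith [mul_le_mul_of_nonneg_left ha2 hc, mul_le_mul_of_nonneg_left hb2 hd]
        · linarith [mul_le_mul_of_nonneg_left ha3 hc, mul_le_mul_of_nonneg_left hb3 hd]
    obtain ⟨h0, h1, h2, h3⟩ := key hy
    simp only [Pi.smul_apply, smul_eq_mul]
    refine ⟨by positivity, ?_, ?_, ?_⟩
    · linarith [mul_le_mul_of_nonneg_left h1 ht.le]
    · linarith [mul_le_mul_of_nonneg_left h2 ht.le]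
    · linarith [mul_le_mul_of_nonneg_left h3 ht.le]
  · rintro ⟨h0, h1, h2, h3⟩
    have hsum := (convex_convexHull ℝ
      ({![0, 0, 0], ![1, 0, 0], ![0, 1, 0], ![1, 1, (m : ℝ)]} : Set (Fin 3 → ℝ))).sum_mem
      (t := Finset.univ)
      (w := ![(m * t + x 2 - m * (x 0 + x 1)) / (m * t), (m * x 0 - x 2) / (m * t),
        (m * x 1 - x 2) / (m * t), x 2 / (m * t)])
      (z := ![![0, 0, 0], ![1, 0, 0], ![0, 1, 0], ![1, 1, (m : ℝ)]])
      (by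
        intro i _
        fin_cases i <;> simp <;> apply div_nonneg <;> linarith)
      (by
        simp [Fin.sum_univ_four]
        field_simp
        ring)
      (by
        intro i _
        apply subset_convexHull
        fin_cases i <;> simp)
    refine ⟨_, hsum, ?_⟩
    ext i
    fin_cases i <;> simp [Fin.sum_univ_four] <;> field_simp <;> ring

/-- A parametrization of the lattice points of `t • reeve m`: the tuple `(r, s, p, w)`
satisfies `r < m` and `w ≤ p ≤ s < t + 1` (`s < t - 1` if `r ≠ 0`). -/
def reeveIndex (m t : ℕ) : Finset ((_ : ℕ) × (_ : ℕ) × (_ : ℕ) × ℕ) :=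
  (Finset.range m).sigma fun r =>
    (Finset.range (if r = 0 then t + 1 else t - 1)).sigma fun s =>
      (Finset.range (s + 1)).sigma fun p => Finset.range (p + 1)

/-- The lattice point attached to an index in `reeveIndex m t`. -/
def reevePoint (m : ℕ) (a : (_ : ℕ) × (_ : ℕ) × (_ : ℕ) × ℕ) : Fin 3 → ℤ :=
  ![(if a.1 = 0 then 0 else 1) + a.2.2.1,
    (if a.1 = 0 then 0 else 1) + a.2.1 - a.2.2.1 + a.2.2.2,
    m * a.2.2.2 + a.1]

theorem sum_range_sum_range_succ (n : ℕ) :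
    ((∑ s ∈ Finset.range n, ∑ p ∈ Finset.range (s + 1), (p + 1) : ℕ) : ℚ) =
      n * (n + 1) * (n + 2) / 6 := by
  have h (k : ℕ) : ((∑ p ∈ Finset.range k, (p + 1) : ℕ) : ℚ) = k * (k + 1) / 2 := by
    induction k with
    | zero => simp
    | succ k ih => rw [Finset.sum_range_succ, Nat.cast_add, ih]; push_cast; ring
  induction n with
  | zero => simp
  | succ n ih => rw [Finset.sum_range_succ, Nat.cast_add, ih, h]; push_cast; ring

theorem card_reeveIndex {m t : ℕ} (hm : 0 < m) (ht : 0 < t) :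
    ((reeveIndex m t).card : ℚ) =
      (m : ℚ) / 6 * (t : ℚ) ^ 3 + (t : ℚ) ^ 2 + (12 - (m : ℚ)) / 6 * (t : ℚ) + 1 := by
  obtain ⟨m, rfl⟩ := Nat.exists_eq_succ_of_ne_zero hm.ne'
  obtain ⟨t, rfl⟩ := Nat.exists_eq_succ_of_ne_zero ht.ne'
  simp only [reeveIndex, Finset.card_sigma, Finset.card_range, Nat.succ_eq_add_one]
  rw [Nat.cast_sum]
  simp only [sum_range_sum_range_succ]
  rw [Finset.sum_range_succ']
  simp only [Nat.add_eq_zero_iff, one_ne_zero, and_false, if_false, if_true,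
    Finset.sum_const, Finset.card_range, nsmul_eq_mul, Nat.add_sub_cancel]
  push_cast
  ring

theorem injOn_reevePoint (m t : ℕ) : Set.InjOn (reevePoint m) (reeveIndex m t) := by
  rintro ⟨r, s, p, w⟩ h ⟨r', s', p', w'⟩ h' heq
  simp only [reeveIndex, Finset.coe_sigma, Set.mem_sigma_iff, Finset.mem_coe,
    Finset.mem_range] at h h'
  have e0 := congrFun heq 0
  have e1 := congrFun heq 1
  have e2 := congrFun heq 2
  simp only [reevePoint, Matrix.cons_val] at e0 e1 e2
  have e2' : m * w + r = m * w' + r' := by exact_mod_cast e2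
  obtain rfl : r = r' := by
    have := congrArg (· % m) e2'
    simpa [Nat.mul_add_mod, Nat.mod_eq_of_lt h.1, Nat.mod_eq_of_lt h'.1] using this
  obtain rfl : w = w' :=
    Nat.eq_of_mul_eq_mul_left (by omega : 0 < m) (by omega)
  obtain rfl : p = p' := by omega
  obtain rfl : s = s' := by omega
  rfl

theorem image_reevePoint {m t : ℕ} (hm : 0 < m) (ht : 0 < t) :
    reevePoint m '' reeveIndex m t =
      {x : Fin 3 → ℤ | 0 ≤ x 2 ∧ x 2 ≤ m * x 0 ∧ x 2 ≤ m * x 1 ∧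
        m * (x 0 + x 1) ≤ m * t + x 2} := by
  have hm' : (0 : ℤ) < m := by exact_mod_cast hm
  ext x
  constructor
  · rintro ⟨⟨r, s, p, w⟩, h, rfl⟩
    simp only [reeveIndex, Finset.mem_coe, Finset.mem_sigma, Finset.mem_range] at h
    obtain ⟨hr, hs, hp, hw⟩ := h
    simp only [reevePoint, Set.mem_ofPred_eq, Matrix.cons_val]
    have hr' : (r : ℤ) < m := by exact_mod_cast hr
    split_ifs at hs ⊢ with h0
    · subst h0
      rw [Nat.cast_zero]
      refine ⟨by positivity, ?_, ?_, ?_⟩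
      · nlinarith [show (w : ℤ) ≤ p by omega]
      · nlinarith [show (p : ℤ) ≤ s by omega]
      · nlinarith [show (s : ℤ) ≤ t by omega]
    · refine ⟨by positivity, ?_, ?_, ?_⟩
      · nlinarith [show (w : ℤ) ≤ p by omega]
      · nlinarith [show (p : ℤ) ≤ s by omega]
      · nlinarith [show (s : ℤ) + 2 ≤ t by omega]
  · rintro ⟨h0, h1, h2, h3⟩
    obtain ⟨w, hw⟩ := Int.eq_ofNat_of_zero_le (Int.ediv_nonneg h0 hm'.le)
    obtain ⟨r, hr⟩ := Int.eq_ofNat_of_zero_le (Int.emod_nonneg (x 2) hm'.ne')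
    have hrm := Int.emod_lt_of_pos (x 2) hm'
    have hx := Int.mul_ediv_add_emod (x 2) m
    rw [hw, hr] at hx
    rw [hr] at hrm
    by_cases hr0 : r = 0
    · subst hr0
      have a1 : (w : ℤ) ≤ x 0 := le_of_mul_le_mul_left (by push_cast at hx; linarith) hm'
      have a2 : (w : ℤ) ≤ x 1 := le_of_mul_le_mul_left (by push_cast at hx; linarith) hm'
      have a3 : x 0 + x 1 ≤ t + w := le_of_mul_le_mul_left (by push_cast at hx; linarith) hm'
      refine ⟨⟨0, (x 0 + x 1 - w).toNat, (x 0).toNat, w⟩, ?_, ?_⟩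
      · simp only [reeveIndex, Finset.mem_coe, Finset.mem_sigma, Finset.mem_range, if_true]
        omega
      · ext i
        fin_cases i <;> simp [reevePoint] <;> omega
    · have hrp : (0 : ℤ) < r := by omega
      have a1 : (w : ℤ) < x 0 := lt_of_mul_lt_mul_left (by linarith) hm'.le
      have a2 : (w : ℤ) < x 1 := lt_of_mul_lt_mul_left (by linarith) hm'.le
      have a3 : x 0 + x 1 < t + w + 1 := lt_of_mul_lt_mul_left (by linarith) hm'.le
      refine ⟨⟨r, (x 0 + x 1 - w - 2).toNat, (x 0 - 1).toNat, w⟩, ?_, ?_⟩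
      · simp only [reeveIndex, Finset.mem_coe, Finset.mem_sigma, Finset.mem_range, if_neg hr0]
        omega
      · ext i
        fin_cases i <;> simp [reevePoint, hr0] <;> omega

/-- The Ehrhart polynomial of the Reeve tetrahedron:
`i(T_m, t) = (m/6)t³ + t² + ((12−m)/6)t + 1`. -/
theorem reeve_latticeCount (m t : ℕ) (hm : 0 < m) (ht : 0 < t) :
    (latticeCount (reeve m) t : ℚ) =
      (m : ℚ) / 6 * (t : ℚ) ^ 3 + (t : ℚ) ^ 2 + (12 - (m : ℚ)) / 6 * (t : ℚ) + 1 := by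
  have ht' : (0 : ℝ) < t := by exact_mod_cast ht
  have hset : {x : Fin 3 → ℝ | x ∈ (t : ℝ) • reeve m ∧ ∀ i, ∃ z : ℤ, x i = (z : ℝ)} =
      (fun (y : Fin 3 → ℤ) i => (y i : ℝ)) '' (reevePoint m '' reeveIndex m t) := by
    rw [image_reevePoint hm ht]
    ext x
    simp only [Set.mem_ofPred_eq, mem_smul_reeve_iff hm ht', Set.mem_image]
    constructor
    · rintro ⟨hx, hz⟩
      choose z hz using hz
      obtain rfl : x = fun i => (z i : ℝ) := funext hz
      beta_reduce at hx
      exact ⟨z, by exact_mod_cast hx, rfl⟩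
    · rintro ⟨y, hy, rfl⟩
      exact ⟨by beta_reduce; exact_mod_cast hy, fun i => ⟨y i, rfl⟩⟩
  have hinj : Function.Injective (fun (y : Fin 3 → ℤ) i => (y i : ℝ)) :=
    fun a b h => funext fun i => Int.cast_injective (congrFun h i)
  rw [latticeCount, hset, Set.ncard_image_of_injective _ hinj,
    (injOn_reevePoint m t).ncard_image, Set.ncard_coe_finset,
    card_reeveIndex hm ht]
end

section
/- For every integer d ≥ 4 there exist a full-dimensional integral polytope P ⊆ ℝ^d and a polynomial p of degree d with rational coefficients and constant coefficient 1 such that i(P,t) = p(t) for every positive integer t, the coefficients of t^{d−2} and t^{d−3} in p are positive, and the coefficient of t^j in p is negative for every j with 1 ≤ j < d−3. -/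
open scoped Pointwise BigOperators

open Polynomial in
/-- `P` is a lattice polytope with interior points and Ehrhart polynomial `p`. -/
structure HasEhrhartPolynomial {N : ℕ} (P : Set (Fin N → ℝ)) (p : ℚ[X]) : Prop where
  integral : IsIntegralPolytope P
  interior_nonempty : (interior P).Nonempty
  natDegree_eq : p.natDegree = N
  coeff_zero : p.coeff 0 = 1
  count : ∀ t : ℕ, 0 < t → (latticeCount P t : ℚ) = p.eval (t : ℚ)

/-- The lattice points of a dilate may be counted as integer vectors. -/
theorem latticeCount_eq_ncard {N : ℕ} (P : Set (Fin N → ℝ)) (t : ℕ) :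
    latticeCount P t = Set.ncard {z : Fin N → ℤ | (fun i => (z i : ℝ)) ∈ (t : ℝ) • P} := by
  have hinj : Function.Injective (fun (z : Fin N → ℤ) (i : Fin N) => (z i : ℝ)) := by
    intro x y h
    funext i
    exact Int.cast_injective (congrFun h i)
  rw [latticeCount, ← Set.ncard_image_of_injective _ hinj]
  congr 1
  ext x
  constructor
  · rintro ⟨hx, hz⟩
    choose z hz using hz
    obtain rfl : x = fun i => (z i : ℝ) := funext hz
    exact ⟨z, hx, rfl⟩
  · rintro ⟨z, hz, rfl⟩
    exact ⟨hz, fun i => ⟨z i, rfl⟩⟩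

/-- The prism of height `w` over `P`, the new coordinate being the first one. -/
def prism {N : ℕ} (P : Set (Fin N → ℝ)) (w : ℕ) : Set (Fin (N + 1) → ℝ) :=
  {x | (0 ≤ x 0 ∧ x 0 ≤ w) ∧ Fin.tail x ∈ P}

theorem IsIntegralPolytope.prism {N : ℕ} {P : Set (Fin N → ℝ)} (hP : IsIntegralPolytope P)
    (w : ℕ) : IsIntegralPolytope (prism P w) := by
  classical
  obtain ⟨V, hV, rfl⟩ := hP
  let f : (ℝ × (Fin N → ℝ)) →ₗ[ℝ] (Fin (N + 1) → ℝ) :=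
    { toFun := fun y => Fin.cons y.1 y.2
      map_add' := fun x y => by
        funext i
        refine Fin.cases ?_ (fun j => ?_) i <;> simp
      map_smul' := fun c y => by
        funext i
        refine Fin.cases ?_ (fun j => ?_) i <;> simp }
  refine ⟨(({0, (w : ℝ)} : Finset ℝ) ×ˢ V).image f, ?_, ?_⟩
  · intro v hv i
    simp only [Finset.mem_image, Finset.mem_product, Finset.mem_insert,
      Finset.mem_singleton] at hv
    obtain ⟨⟨r, u⟩, ⟨hr, hu⟩, rfl⟩ := hv
    refine Fin.cases ?_ (fun j => ?_) i
    · rcases hr with rfl | rfl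
      · exact ⟨0, by simp [f]⟩
      · exact ⟨w, by simp [f]⟩
    · obtain ⟨z, hz⟩ := hV u hu j
      exact ⟨z, by simpa [f] using hz⟩
  · rw [Finset.coe_image, ← LinearMap.image_convexHull, Finset.coe_product, convexHull_prod,
      Finset.coe_pair, convexHull_pair, segment_eq_Icc (Nat.cast_nonneg w)]
    ext x
    constructor
    · rintro ⟨hx, hx'⟩
      exact ⟨(x 0, Fin.tail x), ⟨hx, hx'⟩, Fin.cons_self_tail x⟩
    · rintro ⟨⟨r, u⟩, ⟨hr, hu⟩, rfl⟩
      exact ⟨by simpa [f] using hr, by simpa [f] using hu⟩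

theorem interior_prism_nonempty {N : ℕ} {P : Set (Fin N → ℝ)} (hP : (interior P).Nonempty)
    {w : ℕ} (hw : 0 < w) : (interior (prism P w)).Nonempty := by
  obtain ⟨u, hu⟩ := hP
  have hw' : (0 : ℝ) < w := by exact_mod_cast hw
  refine ⟨Fin.cons (w / 2 : ℝ) u, mem_interior.2
    ⟨{x | (0 < x 0 ∧ x 0 < w) ∧ Fin.tail x ∈ interior P}, ?_, ?_, ?_⟩⟩
  · rintro x ⟨⟨h0, h1⟩, h2⟩
    exact ⟨⟨h0.le, h1.le⟩, interior_subset h2⟩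
  · have htail : Continuous (fun x : Fin (N + 1) → ℝ => Fin.tail x) :=
      continuous_pi fun i => continuous_apply i.succ
    exact ((isOpen_lt continuous_const (continuous_apply 0)).inter
      (isOpen_lt (continuous_apply 0) continuous_const)).inter
      (isOpen_interior.preimage htail)
  · exact ⟨⟨by simpa using hw, by simpa using hw⟩, by simpa using hu⟩

theorem smul_prism {N : ℕ} (P : Set (Fin N → ℝ)) (w : ℕ) {t : ℝ} (ht : 0 < t) :
    t • prism P w = {x : Fin (N + 1) → ℝ | (0 ≤ x 0 ∧ x 0 ≤ w * t) ∧ Fin.tail x ∈ t • P} := by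
  ext x
  have htail : Fin.tail (t⁻¹ • x) = t⁻¹ • Fin.tail x := rfl
  rw [Set.mem_smul_set_iff_inv_smul_mem₀ ht.ne', Set.mem_ofPred_eq,
    Set.mem_smul_set_iff_inv_smul_mem₀ ht.ne', prism, Set.mem_ofPred_eq, htail, Pi.smul_apply,
    smul_eq_mul, inv_mul_le_iff₀ ht, mul_comm t, mul_nonneg_iff_of_pos_left (inv_pos.2 ht)]

theorem latticeCount_prism {N : ℕ} (P : Set (Fin N → ℝ)) (w : ℕ) {t : ℕ} (ht : 0 < t) :
    latticeCount (prism P w) t = latticeCount P t * (w * t + 1) := by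
  have hinj : Function.Injective
      (fun y : ℤ × (Fin N → ℤ) => (Fin.cons y.1 y.2 : Fin (N + 1) → ℤ)) := by
    rintro ⟨a, u⟩ ⟨b, v⟩ h
    simpa [Fin.cons_inj] using h
  rw [latticeCount_eq_ncard, latticeCount_eq_ncard, smul_prism P w (by exact_mod_cast ht)]
  have hset : {z : Fin (N + 1) → ℤ | (fun i => (z i : ℝ)) ∈
        {x : Fin (N + 1) → ℝ | (0 ≤ x 0 ∧ x 0 ≤ w * (t : ℝ)) ∧ Fin.tail x ∈ (t : ℝ) • P}} =
      (fun y : ℤ × (Fin N → ℤ) => (Fin.cons y.1 y.2 : Fin (N + 1) → ℤ)) ''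
        (Set.Icc (0 : ℤ) (w * t : ℕ) ×ˢ
          {z : Fin N → ℤ | (fun i => (z i : ℝ)) ∈ (t : ℝ) • P}) := by
    ext z
    constructor
    · rintro ⟨⟨h0, h1⟩, h2⟩
      have h0' : 0 ≤ z 0 := Int.cast_nonneg_iff.1 h0
      have h1' : z 0 ≤ (w * t : ℕ) := by
        rw [← @Int.cast_le ℝ]
        push_cast
        exact h1
      exact ⟨(z 0, Fin.tail z), ⟨⟨h0', h1'⟩, h2⟩,
        Fin.cons_self_tail z⟩
    · rintro ⟨⟨a, u⟩, ⟨⟨h0, h1⟩, h2⟩, rfl⟩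
      exact ⟨⟨by simpa using h0, by simpa using (Int.cast_le (R := ℝ)).2 h1⟩, h2⟩
  rw [hset, Set.ncard_image_of_injective _ hinj, Set.ncard_prod, mul_comm,
    ← Finset.coe_Icc, Set.ncard_coe_finset, Int.card_Icc]
  congr 1

open Polynomial in
theorem HasEhrhartPolynomial.prism {N : ℕ} {P : Set (Fin N → ℝ)} {p : ℚ[X]}
    (h : HasEhrhartPolynomial P p) {w : ℕ} (hw : 0 < w) :
    HasEhrhartPolynomial (prism P w) (p * (C (w : ℚ) * X + 1)) where
  integral := h.integral.prism w
  interior_nonempty := interior_prism_nonempty h.interior_nonempty hw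
  natDegree_eq := by
    have hp : p ≠ 0 := by
      rintro rfl
      simpa using h.coeff_zero
    have hw' : (w : ℚ) ≠ 0 := by exact_mod_cast hw.ne'
    have hq : (C (w : ℚ) * X + 1 : ℚ[X]).natDegree = 1 := natDegree_linear hw'
    rw [natDegree_mul hp (ne_zero_of_natDegree_gt (n := 0) (by omega)), hq, h.natDegree_eq]
  coeff_zero := by simp [mul_coeff_zero, h.coeff_zero]
  count t ht := by
    rw [latticeCount_prism P w ht, Nat.cast_mul, h.count t ht]
    simp

/-- The tetrahedron that is the join of segments of lengths `4` and `b`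
in skew directions at heights `1` and `0`. -/
def skewTetrahedron (b : ℕ) : Set (Fin 3 → ℝ) :=
  {x | (0 ≤ x 0 ∧ x 0 ≤ 4 * x 2) ∧ (0 ≤ x 1 ∧ x 1 ≤ b * (1 - x 2))}

theorem isIntegralPolytope_skewTetrahedron {b : ℕ} (hb : 0 < b) :
    IsIntegralPolytope (skewTetrahedron b) := by
  classical
  have hb' : (0 : ℝ) < b := by exact_mod_cast hb
  let v : Fin 4 → Fin 3 → ℝ := ![![4, 0, 1], ![0, 0, 1], ![0, b, 0], ![0, 0, 0]]
  refine ⟨Finset.univ.image v, ?_, ?_⟩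
  · intro u hu i
    obtain ⟨k, -, rfl⟩ := Finset.mem_image.1 hu
    have hz : ∀ k i, v k i =
        ((![![4, 0, 1], ![0, 0, 1], ![0, (b : ℤ), 0], ![0, 0, 0]] : Fin 4 → Fin 3 → ℤ) k i) := by
      intro k i
      fin_cases k <;> fin_cases i <;> simp [v]
    exact ⟨_, hz k i⟩
  · apply Set.Subset.antisymm
    · rintro x ⟨⟨h0, h1⟩, h2, h3⟩
      have hmem : ∀ k, v k ∈ convexHull ℝ ((Finset.univ.image v : Finset _) : Set (Fin 3 → ℝ)) :=
        fun k => subset_convexHull ℝ _ (by simp)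
      have hq : x 1 / b ≤ 1 - x 2 := by
        rw [div_le_iff₀ hb']
        linarith
      have hsum := (convex_convexHull ℝ
          ((Finset.univ.image v : Finset _) : Set (Fin 3 → ℝ))).sum_mem
        (t := Finset.univ) (w := ![x 0 / 4, x 2 - x 0 / 4, x 1 / b, 1 - x 2 - x 1 / b])
        (z := v) (by
          intro k _
          have := div_nonneg h2 hb'.le
          fin_cases k <;> simp <;> linarith)
        (by simp [Fin.sum_univ_four]) (fun k _ => hmem k)
      convert hsum using 1
      funext i
      fin_cases i <;> simp [Fin.sum_univ_four, v] <;> field_simp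
    · refine convexHull_min ?_ ?_
      · intro u hu
        obtain ⟨k, -, rfl⟩ := Finset.mem_image.1 (Finset.mem_coe.1 hu)
        fin_cases k <;> simp [v, skewTetrahedron]
      · rintro x ⟨⟨hx0, hx1⟩, hx2, hx3⟩ y ⟨⟨hy0, hy1⟩, hy2, hy3⟩ r s hr hs hrs
        obtain rfl : s = 1 - r := by linarith
        simp only [skewTetrahedron, Set.mem_ofPred_eq, Pi.add_apply, Pi.smul_apply, smul_eq_mul]
        refine ⟨⟨by positivity, ?_⟩, by positivity, ?_⟩
        · nlinarith [mul_le_mul_of_nonneg_left hx1 hr, mul_le_mul_of_nonneg_left hy1 hs]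
        · nlinarith [mul_le_mul_of_nonneg_left hx3 hr, mul_le_mul_of_nonneg_left hy3 hs]

theorem interior_skewTetrahedron_nonempty {b : ℕ} (hb : 0 < b) :
    (interior (skewTetrahedron b)).Nonempty := by
  have hb' : (0 : ℝ) < b := by exact_mod_cast hb
  refine ⟨![1, b / 4, 1 / 2], mem_interior.2
    ⟨{x | (0 < x 0 ∧ x 0 < 4 * x 2) ∧ (0 < x 1 ∧ x 1 < b * (1 - x 2))}, ?_, ?_, ?_⟩⟩
  · rintro x ⟨⟨h0, h1⟩, h2, h3⟩
    exact ⟨⟨h0.le, h1.le⟩, h2.le, h3.le⟩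
  · have h0 : IsOpen {x : Fin 3 → ℝ | 0 < x 0} := isOpen_lt (by fun_prop) (by fun_prop)
    have h1 : IsOpen {x : Fin 3 → ℝ | x 0 < 4 * x 2} := isOpen_lt (by fun_prop) (by fun_prop)
    have h2 : IsOpen {x : Fin 3 → ℝ | 0 < x 1} := isOpen_lt (by fun_prop) (by fun_prop)
    have h3 : IsOpen {x : Fin 3 → ℝ | x 1 < b * (1 - x 2)} :=
      isOpen_lt (by fun_prop) (by fun_prop)
    exact (h0.inter h1).inter (h2.inter h3)
  · refine ⟨⟨?_, ?_⟩, ?_, ?_⟩ <;> simp <;> linarith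

theorem latticeCount_skewTetrahedron {b t : ℕ} (hb : 0 < b) (ht : 0 < t) :
    latticeCount (skewTetrahedron b) t =
      ∑ s ∈ Finset.range (t + 1), (4 * s + 1) * (b * (t - s) + 1) := by
  have ht' : (0 : ℝ) < t := by exact_mod_cast ht
  let f : (Σ _ : ℕ, ℕ × ℕ) → Fin 3 → ℤ := fun y => ![(y.2.1 : ℤ), (y.2.2 : ℤ), (y.1 : ℤ)]
  have hinj : Function.Injective f := by
    rintro ⟨s, x, y⟩ ⟨s', x', y'⟩ h
    have h0 := congrFun h 0
    have h1 := congrFun h 1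
    have h2 := congrFun h 2
    simp only [f, Matrix.cons_val, Nat.cast_inj] at h0 h1 h2
    subst h0 h1 h2
    rfl
  have hmem : ∀ z : Fin 3 → ℤ, (fun i => (z i : ℝ)) ∈ (t : ℝ) • skewTetrahedron b ↔
      (0 ≤ z 0 ∧ z 0 ≤ 4 * z 2) ∧ (0 ≤ z 1 ∧ z 1 ≤ b * (t - z 2)) := by
    intro z
    have h1 : (t : ℝ)⁻¹ * z 0 ≤ 4 * ((t : ℝ)⁻¹ * z 2) ↔ z 0 ≤ 4 * z 2 := by
      rw [inv_mul_le_iff₀ ht', ← @Int.cast_le ℝ]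
      push_cast
      field_simp
    have h2 : (t : ℝ)⁻¹ * z 1 ≤ b * (1 - (t : ℝ)⁻¹ * z 2) ↔ z 1 ≤ b * (t - z 2) := by
      rw [inv_mul_le_iff₀ ht', ← @Int.cast_le ℝ]
      push_cast
      field_simp
    rw [Set.mem_smul_set_iff_inv_smul_mem₀ ht'.ne', skewTetrahedron, Set.mem_ofPred_eq]
    simp only [Pi.smul_apply, smul_eq_mul]
    rw [h1, h2, mul_nonneg_iff_of_pos_left (inv_pos.2 ht'),
      mul_nonneg_iff_of_pos_left (inv_pos.2 ht'), Int.cast_nonneg_iff, Int.cast_nonneg_iff]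
  have hset : {z : Fin 3 → ℤ | (fun i => (z i : ℝ)) ∈ (t : ℝ) • skewTetrahedron b} =
      f '' ((Finset.range (t + 1)).sigma fun s =>
        Finset.range (4 * s + 1) ×ˢ Finset.range (b * (t - s) + 1)) := by
    ext z
    rw [Set.mem_ofPred_eq, hmem]
    constructor
    · rintro ⟨⟨h0, h1⟩, h2, h3⟩
      have h4 : 0 ≤ z 2 := by omega
      have h5 : z 2 ≤ t := by
        by_contra! h
        have := mul_neg_of_pos_of_neg (Int.natCast_pos.2 hb) (sub_neg.2 h)
        omega
      generalize hx : z 0 = x at *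
      generalize hy : z 1 = y at *
      generalize hs : z 2 = s at *
      lift x to ℕ using h0
      lift y to ℕ using h2
      lift s to ℕ using h4
      refine ⟨⟨s, x, y⟩, ?_, ?_⟩
      · have hst : s ≤ t := by exact_mod_cast h5
        have hy' : y ≤ b * (t - s) := by
          zify [hst]
          exact h3
        simp only [Finset.coe_sigma, Set.mem_sigma_iff, Finset.mem_coe, Finset.mem_product,
          Finset.mem_range]
        omega
      · funext i
        fin_cases i
        exacts [hx.symm, hy.symm, hs.symm]
    · rintro ⟨⟨s, x, y⟩, h, rfl⟩
      simp only [Finset.coe_sigma, Set.mem_sigma_iff, Finset.mem_coe, Finset.mem_product,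
        Finset.mem_range, Nat.lt_succ_iff] at h
      obtain ⟨hs, hx, hy⟩ := h
      zify [hs] at hx hy
      simp only [f, Matrix.cons_val]
      exact ⟨⟨Int.natCast_nonneg x, hx⟩, Int.natCast_nonneg y, hy⟩
  rw [latticeCount_eq_ncard, hset, Set.ncard_image_of_injective _ hinj, Set.ncard_coe_finset,
    Finset.card_sigma]
  simp

theorem sum_range_linear_mul_linear (b c : ℚ) (n : ℕ) :
    ∑ s ∈ Finset.range n, (4 * (s : ℚ) + 1) * (b * (c - s) + 1) =
      b * c * (n * (2 * n - 1)) + n * (2 * n - 1)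
        - b * (2 * n * (n - 1) * (2 * n - 1) / 3 + n * (n - 1) / 2) := by
  induction n with
  | zero => simp
  | succ n ih =>
    rw [Finset.sum_range_succ, ih]
    push_cast
    ring

open Polynomial in
theorem hasEhrhartPolynomial_skewTetrahedron {m : ℕ} (hm : 0 < m) :
    HasEhrhartPolynomial (skewTetrahedron (6 * m))
      (2 * X ^ 2 + 3 * X + 1 + C (m : ℚ) * (4 * X ^ 3 + 3 * X ^ 2 - X)) where
  integral := isIntegralPolytope_skewTetrahedron (by omega)
  interior_nonempty := interior_skewTetrahedron_nonempty (by omega)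
  natDegree_eq := by
    have hm' : (m : ℚ) ≠ 0 := by exact_mod_cast hm.ne'
    compute_degree!
    exact hm.ne'
  coeff_zero := by simp [coeff_X]
  count t ht := by
    have hsum : (∑ s ∈ Finset.range (t + 1), ((4 * s + 1) * (6 * m * (t - s) + 1) : ℕ) : ℚ) =
        ∑ s ∈ Finset.range (t + 1), (4 * (s : ℚ) + 1) * ((6 * m : ℚ) * (t - s) + 1) := by
      refine Finset.sum_congr rfl fun s hs => ?_
      have : s ≤ t := by simpa [Nat.lt_succ_iff] using hs
      push_cast [this]
      ring
    rw [latticeCount_skewTetrahedron (by omega) ht, Nat.cast_sum, hsum, sum_range_linear_mul_linear]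
    simp
    ring

open Polynomial in
/-- Suitable prisms over the tetrahedra `skewTetrahedron (6 * m)`: the part of the Ehrhart
polynomial that is linear in `m` has the required signs. -/
theorem exists_prism_family (k : ℕ) : ∃ q : ℚ[X],
    (∀ j, 1 ≤ j → j ≤ k + 1 → ((4 * X ^ 3 + 3 * X ^ 2 - X) * q).coeff j < 0) ∧
    (∀ j, k + 2 ≤ j → j ≤ k + 5 → 0 < ((4 * X ^ 3 + 3 * X ^ 2 - X) * q).coeff j) ∧
    ∀ m : ℕ, 0 < m → ∃ P : Set (Fin (k + 5) → ℝ), HasEhrhartPolynomial P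
      ((2 * X ^ 2 + 3 * X + 1 + C (m : ℚ) * (4 * X ^ 3 + 3 * X ^ 2 - X)) * q) := by
  suffices h : ∃ q : ℚ[X], ((4 * X ^ 3 + 3 * X ^ 2 - X) * q).natDegree ≤ k + 5 ∧
      (∀ j, 1 ≤ j → j ≤ k + 1 → ((4 * X ^ 3 + 3 * X ^ 2 - X) * q).coeff j < 0) ∧
      (∀ j, k + 2 ≤ j → j ≤ k + 5 → 0 < ((4 * X ^ 3 + 3 * X ^ 2 - X) * q).coeff j) ∧
      ∀ m : ℕ, 0 < m → ∃ P : Set (Fin (k + 5) → ℝ), HasEhrhartPolynomial P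
        ((2 * X ^ 2 + 3 * X + 1 + C (m : ℚ) * (4 * X ^ 3 + 3 * X ^ 2 - X)) * q) by
    obtain ⟨q, -, h⟩ := h
    exact ⟨q, h⟩
  induction k with
  | zero =>
    have hexp : ((4 * X ^ 3 + 3 * X ^ 2 - X) * ((C ((1 : ℕ) : ℚ) * X + 1) *
        (C ((1 : ℕ) : ℚ) * X + 1)) : ℚ[X]) =
        C 4 * X ^ 5 + C 11 * X ^ 4 + C 9 * X ^ 3 + X ^ 2 - X := by
      simp only [Nat.cast_one, map_one, map_ofNat]
      ring
    refine ⟨(C ((1 : ℕ) : ℚ) * X + 1) * (C ((1 : ℕ) : ℚ) * X + 1), ?_, ?_, ?_,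
      fun m hm => ?_⟩
    · rw [hexp]
      compute_degree
    · intro j h1 h2
      rw [hexp]
      interval_cases j
      simp [coeff_X, coeff_X_pow]
    · intro j h1 h2
      rw [hexp]
      interval_cases j <;> simp [coeff_X, coeff_X_pow]
    · rw [← mul_assoc]
      exact ⟨_, ((hasEhrhartPolynomial_skewTetrahedron hm).prism one_pos).prism one_pos⟩
  | succ k ih =>
    obtain ⟨q, hdeg, hneg, hpos, hP⟩ := ih
    set g : ℚ[X] := (4 * X ^ 3 + 3 * X ^ 2 - X) * q with hg
    obtain ⟨w, hw⟩ := exists_nat_gt (g.coeff (k + 2) / -g.coeff (k + 1))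
    have hk := hneg (k + 1) (by omega) le_rfl
    have hw' : g.coeff (k + 2) + w * g.coeff (k + 1) < 0 := by
      rw [div_lt_iff₀ (by linarith)] at hw
      linarith
    have hw0 : 0 < w := by
      have := hpos (k + 2) le_rfl (by omega)
      rcases Nat.eq_zero_or_pos w with rfl | h
      · simp at hw'
        linarith
      · exact h
    have hw0' : (0 : ℚ) < w := by exact_mod_cast hw0
    have hcoeff : ∀ j, (g * (C (w : ℚ) * X + 1)).coeff (j + 1) =
        g.coeff (j + 1) + w * g.coeff j := by
      intro j
      rw [mul_add, mul_one, coeff_add, ← mul_assoc, coeff_mul_X, coeff_mul_C]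
      ring
    have hg0 : g.coeff 0 = 0 := by simp [hg, mul_coeff_zero]
    have hgdeg : g.coeff (k + 6) = 0 :=
      coeff_eq_zero_of_natDegree_lt (by omega)
    refine ⟨q * (C (w : ℚ) * X + 1), ?_, ?_, ?_, fun m hm => ?_⟩
    · rw [← mul_assoc]
      have := natDegree_mul_le_of_le hdeg (natDegree_linear_le (a := (w : ℚ)) (b := 1))
      rw [map_one] at this
      omega
    · intro j h1 h2
      obtain ⟨j, rfl⟩ := Nat.exists_eq_add_of_le' h1
      rw [← mul_assoc, hcoeff]
      rcases Nat.eq_zero_or_pos j with rfl | hj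
      · simpa [hg0] using hneg 1 le_rfl (by omega)
      · rcases Nat.lt_or_ge j (k + 1) with hj' | hj'
        · have := hneg (j + 1) (by omega) (by omega)
          have := mul_neg_of_pos_of_neg hw0' (hneg j hj (by omega))
          linarith
        · obtain rfl : j = k + 1 := by omega
          exact hw'
    · intro j h1 h2
      obtain ⟨j, rfl⟩ := Nat.exists_eq_add_of_le' (show 1 ≤ j by omega)
      rw [← mul_assoc, hcoeff]
      have := mul_pos hw0' (hpos j (by omega) (by omega))
      rcases Nat.lt_or_ge j (k + 5) with hj' | hj'
      · have := hpos (j + 1) (by omega) (by omega)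
        linarith
      · obtain rfl : j = k + 5 := by omega
        linarith
    · obtain ⟨P, hP⟩ := hP m hm
      rw [← mul_assoc]
      exact ⟨_, hP.prism hw0⟩

theorem eventually_pos_add_natCast_mul (a : ℚ) {c : ℚ} (hc : 0 < c) :
    ∀ᶠ m : ℕ in Filter.atTop, 0 < a + m * c :=
  (Filter.tendsto_atTop_add_const_left _ a
    (tendsto_natCast_atTop_atTop.atTop_mul_const hc)).eventually_gt_atTop 0

open Polynomial in
theorem two_positive (d : ℕ) (hd : 4 ≤ d) :
    ∃ (P : Set (Fin d → ℝ)) (p : Polynomial ℚ),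
      IsIntegralPolytope P ∧ affineSpan ℝ P = ⊤ ∧
      p.natDegree = d ∧ p.coeff 0 = 1 ∧
      (∀ t : ℕ, 0 < t → (latticeCount P t : ℚ) = p.eval (t : ℚ)) ∧
      0 < p.coeff (d - 2) ∧ 0 < p.coeff (d - 3) ∧
      (∀ j : ℕ, 1 ≤ j → j < d - 3 → p.coeff j < 0) := by
  suffices h : ∃ (P : Set (Fin d → ℝ)) (p : Polynomial ℚ), HasEhrhartPolynomial P p ∧
      0 < p.coeff (d - 2) ∧ 0 < p.coeff (d - 3) ∧
      (∀ j : ℕ, 1 ≤ j → j < d - 3 → p.coeff j < 0) by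
    obtain ⟨P, p, hP, h⟩ := h
    refine ⟨P, p, hP.integral, top_unique ?_, hP.natDegree_eq, hP.coeff_zero, hP.count, h⟩
    rw [← isOpen_interior.affineSpan_eq_top hP.interior_nonempty]
    exact affineSpan_mono ℝ interior_subset
  rcases hd.eq_or_lt with rfl | hd
  · have hexp : ((2 * X ^ 2 + 3 * X + 1 + C ((1 : ℕ) : ℚ) * (4 * X ^ 3 + 3 * X ^ 2 - X)) *
        (C ((1 : ℕ) : ℚ) * X + 1) : Polynomial ℚ) =
        C 4 * X ^ 4 + C 9 * X ^ 3 + C 7 * X ^ 2 + C 3 * X + 1 := by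
      simp only [Nat.cast_one, map_one, map_ofNat]
      ring
    refine ⟨_, _, (hasEhrhartPolynomial_skewTetrahedron one_pos).prism one_pos, ?_, ?_, ?_⟩
    · rw [hexp]
      simp [coeff_one]
    · rw [hexp]
      simp [coeff_one]
    · intro j h1 h2
      omega
  · obtain ⟨k, rfl⟩ := Nat.exists_eq_add_of_le' (show 5 ≤ d by omega)
    obtain ⟨q, hneg, hpos, hP⟩ := exists_prism_family k
    set g : Polynomial ℚ := (4 * X ^ 3 + 3 * X ^ 2 - X) * q with hg
    set a : Polynomial ℚ := (2 * X ^ 2 + 3 * X + 1) * q with ha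
    have h2 := eventually_pos_add_natCast_mul (a.coeff (k + 2))
      (hpos (k + 2) le_rfl (by omega))
    have h3 := eventually_pos_add_natCast_mul (a.coeff (k + 3))
      (hpos (k + 3) (by omega) (by omega))
    have h1 : ∀ᶠ m : ℕ in Filter.atTop, ∀ j ∈ Finset.Icc 1 (k + 1),
        0 < -a.coeff j + m * -g.coeff j := by
      rw [Filter.eventually_all_finset]
      intro j hj
      rw [Finset.mem_Icc] at hj
      exact eventually_pos_add_natCast_mul _ (neg_pos.2 (hneg j hj.1 hj.2))
    obtain ⟨m, h1, h2, h3, hm⟩ :=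
      (h1.and (h2.and (h3.and (Filter.eventually_gt_atTop 0)))).exists
    obtain ⟨P, hP⟩ := hP m hm
    have hcoeff : ∀ j, ((2 * X ^ 2 + 3 * X + 1 + C (m : ℚ) * (4 * X ^ 3 + 3 * X ^ 2 - X)) *
        q).coeff j = a.coeff j + m * g.coeff j := by
      intro j
      rw [add_mul, mul_assoc, coeff_add, coeff_C_mul]
    refine ⟨P, _, hP, ?_, ?_, fun j hj1 hj2 => ?_⟩
    · rw [hcoeff]
      exact h3
    · rw [hcoeff]
      exact h2
    · have := h1 j (Finset.mem_Icc.2 ⟨hj1, by omega⟩)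
      rw [hcoeff]
      linarith
end

section
/- For every integer d ≥ 12 there exist a full-dimensional integral polytope P ⊆ ℝ^d and a polynomial p of degree d with rational coefficients and constant coefficient 1 such that i(P,t) = p(t) for every positive integer t, the coefficients of t^{d−2}, t^{d−3} and t^{d−4} in p are positive, and the coefficient of t^j in p is negative for every j with 1 ≤ j < d−4. -/
open scoped Pointwise BigOperators

/-- The polytope of all `v` with `0 ≤ v 0 ≤ 1` whose remaining coordinates `v i.succ` lie between
`0` and the interpolation `a i * (1 - v 0) + b i * v 0`. -/
def boxCayley {e : ℕ} (a b : Fin e → ℕ) : Set (Fin (e + 1) → ℝ) :=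
  {v | 0 ≤ v 0 ∧ v 0 ≤ 1 ∧
    ∀ i : Fin e, 0 ≤ v i.succ ∧ v i.succ ≤ a i * (1 - v 0) + b i * v 0}

/-- The vertices of an axis-parallel box placed at height `h`. -/
def boxVertices {e : ℕ} (h : ℝ) (c : Fin e → ℕ) : Set (Fin (e + 1) → ℝ) :=
  Set.univ.pi (Fin.cons {h} fun i => {0, (c i : ℝ)})

theorem finite_boxVertices {e : ℕ} (h : ℝ) (c : Fin e → ℕ) : (boxVertices h c).Finite := by
  refine Set.Finite.pi fun i => ?_
  induction i using Fin.cases <;> simp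

theorem mem_convexHull_boxVertices {e : ℕ} {h : ℝ} {c : Fin e → ℕ} {v : Fin (e + 1) → ℝ}
    (h0 : v 0 = h) (hs : ∀ i : Fin e, 0 ≤ v i.succ ∧ v i.succ ≤ c i) :
    v ∈ convexHull ℝ (boxVertices h c) := by
  rw [boxVertices, convexHull_pi]
  intro i _
  induction i using Fin.cases with
  | zero => simp [h0]
  | succ i =>
    simp only [Fin.cons_succ, convexHull_pair]
    rw [segment_eq_Icc (Nat.cast_nonneg _)]
    exact hs i

theorem convex_boxCayley {e : ℕ} (a b : Fin e → ℕ) : Convex ℝ (boxCayley a b) := by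
  rintro v ⟨hv0, hv1, hv⟩ w ⟨hw0, hw1, hw⟩ r s hr hs hrs
  refine ⟨?_, ?_, fun i => ⟨?_, ?_⟩⟩ <;> simp only [Pi.add_apply, Pi.smul_apply, smul_eq_mul]
  · positivity
  · nlinarith
  · have := (hv i).1
    have := (hw i).1
    positivity
  · have h1 := mul_le_mul_of_nonneg_left (hv i).2 hr
    have h2 := mul_le_mul_of_nonneg_left (hw i).2 hs
    obtain rfl : r = 1 - s := by linarith
    linarith

theorem boxCayley_eq_convexHull {e : ℕ} (a b : Fin e → ℕ) :
    boxCayley a b = convexHull ℝ (boxVertices 0 a ∪ boxVertices 1 b) := by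
  apply Set.Subset.antisymm
  · rintro v ⟨h0, h1, hv⟩
    set u : Fin e → ℝ := fun i => v i.succ / (a i * (1 - v 0) + b i * v 0) with hu
    have hden (i : Fin e) : (0 : ℝ) ≤ a i * (1 - v 0) + b i * v 0 := (hv i).1.trans (hv i).2
    have hu0 (i : Fin e) : 0 ≤ u i := div_nonneg (hv i).1 (hden i)
    have hu1 (i : Fin e) : u i ≤ 1 := div_le_one_of_le₀ (hv i).2 (hden i)
    have huv (i : Fin e) : v i.succ = u i * (a i * (1 - v 0) + b i * v 0) := by
      rcases (hden i).eq_or_lt with h | h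
      · have := hv i
        rw [← h] at this ⊢
        linarith
      · exact (div_mul_cancel₀ _ h.ne').symm
    have hmem (h : ℝ) (c : Fin e → ℕ) :
        (Fin.cons h fun i => u i * c i : Fin (e + 1) → ℝ) ∈ convexHull ℝ (boxVertices h c) :=
      mem_convexHull_boxVertices (Fin.cons_zero _ _) fun i => by
        rw [Fin.cons_succ]
        exact ⟨mul_nonneg (hu0 i) (Nat.cast_nonneg _),
          mul_le_of_le_one_left (Nat.cast_nonneg _) (hu1 i)⟩
    have key := convex_convexHull ℝ (boxVertices 0 a ∪ boxVertices 1 b)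
      (convexHull_mono Set.subset_union_left (hmem 0 a))
      (convexHull_mono Set.subset_union_right (hmem 1 b)) (sub_nonneg.2 h1) h0 (by ring)
    convert key using 1
    funext i
    induction i using Fin.cases with
    | zero => simp
    | succ i =>
      simp only [Pi.add_apply, Pi.smul_apply, smul_eq_mul, Fin.cons_succ]
      rw [huv i]
      ring
  · refine convexHull_min ?_ (convex_boxCayley a b)
    have hmem (h : ℝ) (c : Fin e → ℕ) (v : Fin (e + 1) → ℝ) (hv : v ∈ boxVertices h c) :
        v 0 = h ∧ ∀ i : Fin e, 0 ≤ v i.succ ∧ v i.succ ≤ c i := by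
      refine ⟨by simpa using hv 0 trivial, fun i => ?_⟩
      have := hv i.succ trivial
      simp only [Fin.cons_succ, Set.mem_insert_iff, Set.mem_singleton_iff] at this
      rcases this with h | h <;> simp [h]
    rintro v (hv | hv) <;> obtain ⟨h0, hs⟩ := hmem _ _ v hv <;>
      refine ⟨by simp [h0], by simp [h0], fun i => by simpa [h0] using hs i⟩

theorem isIntegralPolytope_boxCayley {e : ℕ} (a b : Fin e → ℕ) :
    IsIntegralPolytope (boxCayley a b) := by
  have hfin := (finite_boxVertices 0 a).union (finite_boxVertices 1 b)
  refine ⟨hfin.toFinset, fun v hv i => ?_, by rw [hfin.coe_toFinset, boxCayley_eq_convexHull]⟩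
  rw [hfin.mem_toFinset] at hv
  have hint (h : ℤ) (c : Fin e → ℕ) (hv : v ∈ boxVertices h c) : ∃ z : ℤ, v i = z := by
    have hi := hv i trivial
    induction i using Fin.cases with
    | zero => exact ⟨h, by simpa using hi⟩
    | succ i =>
      simp only [Fin.cons_succ, Set.mem_insert_iff, Set.mem_singleton_iff] at hi
      rcases hi with hi | hi
      · exact ⟨0, by simpa using hi⟩
      · exact ⟨c i, by simpa using hi⟩
  rcases hv with hv | hv
  · exact hint 0 a (by simpa using hv)
  · exact hint 1 b (by simpa using hv)

theorem affineSpan_boxCayley {e : ℕ} (a b : Fin e → ℕ) (hab : ∀ i, 0 < a i + b i) :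
    affineSpan ℝ (boxCayley a b) = ⊤ := by
  apply affineSpan_eq_top_of_nonempty_interior
  rw [(convex_boxCayley a b).convexHull_eq]
  let U : Set (Fin (e + 1) → ℝ) := {v | 0 < v 0 ∧ v 0 < 1 ∧
    ∀ i : Fin e, 0 < v i.succ ∧ v i.succ < a i * (1 - v 0) + b i * v 0}
  have hU : IsOpen U := by
    simp only [U, Set.ofPred_and, Set.ofPred_forall]
    refine (isOpen_lt (by fun_prop) (by fun_prop)).inter
      ((isOpen_lt (by fun_prop) (by fun_prop)).inter (isOpen_iInter_of_finite fun i =>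
        (isOpen_lt (by fun_prop) (by fun_prop)).inter (isOpen_lt (by fun_prop) (by fun_prop))))
  refine ⟨Fin.cons (1 / 2) fun i => ((a i : ℝ) + b i) / 4, interior_maximal ?_ hU ?_⟩
  · rintro v ⟨h0, h1, hv⟩
    exact ⟨h0.le, h1.le, fun i => ⟨(hv i).1.le, (hv i).2.le⟩⟩
  · have hpos (i : Fin e) : (0 : ℝ) < a i + b i := mod_cast hab i
    refine ⟨by norm_num, by norm_num, fun i => ?_⟩
    simp only [Fin.cons_succ, Fin.cons_zero]
    constructor <;> linarith [hpos i]

theorem mem_smul_boxCayley {e : ℕ} (a b : Fin e → ℕ) {t : ℝ} (ht : 0 < t)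
    (v : Fin (e + 1) → ℝ) :
    v ∈ t • boxCayley a b ↔ 0 ≤ v 0 ∧ v 0 ≤ t ∧
      ∀ i : Fin e, 0 ≤ v i.succ ∧ v i.succ ≤ a i * (t - v 0) + b i * v 0 := by
  rw [Set.mem_smul_set_iff_inv_smul_mem₀ ht.ne']
  simp only [boxCayley, Set.mem_ofPred_eq, Pi.smul_apply, smul_eq_mul]
  have hscale (x : ℝ) : 0 ≤ t⁻¹ * x ↔ 0 ≤ x := mul_nonneg_iff_of_pos_left (inv_pos.2 ht)
  refine and_congr (hscale _) (and_congr ?_ (forall_congr' fun i => and_congr (hscale _) ?_))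
  · rw [inv_mul_le_iff₀ ht, mul_one]
  · rw [inv_mul_le_iff₀ ht]
    have : t * (a i * (1 - t⁻¹ * v 0) + b i * (t⁻¹ * v 0)) = a i * (t - v 0) + b i * v 0 := by
      field_simp
    rw [this]

theorem latticeCount_boxCayley {e : ℕ} (a b : Fin e → ℕ) {t : ℕ} (ht : 0 < t) :
    latticeCount (boxCayley a b) t =
      ∑ y ∈ Finset.range (t + 1), ∏ i, (a i * (t - y) + b i * y + 1) := by
  let S : Finset (Σ _ : ℕ, Fin e → ℕ) := (Finset.range (t + 1)).sigma fun y =>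
    Fintype.piFinset fun i => Finset.range (a i * (t - y) + b i * y + 1)
  let f : (Σ _ : ℕ, Fin e → ℕ) → Fin (e + 1) → ℝ := fun s =>
    Fin.cons (s.1 : ℝ) fun i => (s.2 i : ℝ)
  have hf : Function.Injective f := by
    rintro ⟨y, w⟩ ⟨y', w'⟩ h
    obtain ⟨h0, hs⟩ := Fin.cons_inj.1 h
    obtain rfl : y = y' := mod_cast h0
    obtain rfl : w = w' := funext fun i => by exact_mod_cast congrFun hs i
    rfl
  have hS : S.card = ∑ y ∈ Finset.range (t + 1), ∏ i, (a i * (t - y) + b i * y + 1) := by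
    simp [S, Finset.card_sigma, Fintype.card_piFinset]
  have hbound (y : ℕ) (hy : y ≤ t) (i : Fin e) :
      ((a i * (t - y) + b i * y : ℕ) : ℝ) = a i * (t - y) + b i * y := by
    push_cast [hy]
    rfl
  rw [← hS, ← Finset.card_image_of_injective S hf, latticeCount, ← Set.ncard_coe_finset]
  congr 1
  ext v
  simp only [Set.mem_ofPred_eq, mem_smul_boxCayley a b (Nat.cast_pos.2 ht), Finset.coe_image,
    Set.mem_image, Finset.mem_coe]
  constructor
  · rintro ⟨⟨h0, h1, hv⟩, hz⟩
    have hnat (i : Fin (e + 1)) (hi : 0 ≤ v i) : ∃ n : ℕ, v i = n := by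
      obtain ⟨z, hz⟩ := hz i
      lift z to ℕ using by rw [hz] at hi; exact_mod_cast hi
      exact ⟨z, by simpa using hz⟩
    obtain ⟨y, hy⟩ := hnat 0 h0
    choose w hw using fun i : Fin e => hnat i.succ (hv i).1
    have hyt : y ≤ t := by rw [hy] at h1; exact_mod_cast h1
    refine ⟨⟨y, w⟩, ?_, ?_⟩
    · simp only [S, Finset.mem_sigma, Finset.mem_range, Fintype.mem_piFinset, Nat.lt_succ_iff]
      refine ⟨hyt, fun i => ?_⟩
      have := (hv i).2
      rw [hw, hy, ← hbound y hyt i] at this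
      exact_mod_cast this
    · funext i
      induction i using Fin.cases with
      | zero => exact hy.symm
      | succ i => exact (hw i).symm
  · rintro ⟨⟨y, w⟩, hs, rfl⟩
    simp only [S, Finset.mem_sigma, Finset.mem_range, Fintype.mem_piFinset, Nat.lt_succ_iff] at hs
    obtain ⟨hy, hw⟩ := hs
    refine ⟨⟨by simp [f], by simpa [f] using hy, fun i => ?_⟩, fun i => ?_⟩
    · simp only [f, Fin.cons_succ, Fin.cons_zero, ← hbound y hy i]
      exact ⟨Nat.cast_nonneg _, mod_cast hw i⟩
    · induction i using Fin.cases with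
      | zero => exact ⟨y, by simp [f]⟩
      | succ i => exact ⟨w i, by simp [f]⟩

theorem sum_range_mul_linear (k x : ℚ) (t : ℕ) :
    ∑ y ∈ Finset.range (t + 1), (4 * (x - y) + 1) * (6 * k * y + 1) =
      (4 * x + 1) * (t + 1) + (3 * k * (4 * x + 1) - 2) * t * (t + 1)
        - 4 * k * t * (t + 1) * (2 * t + 1) := by
  induction t with
  | zero => simp
  | succ t ih =>
    rw [Finset.sum_range_succ, ih]
    push_cast
    ring

/-- The polynomial `(4k t³ + (3k + 2) t² + (3 - k) t + 1) (t + 1)³ (n t + 1) ^ D`. -/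
noncomputable def ehrhartPoly (k n : ℚ) (D : ℕ) : Polynomial ℚ :=
  ((.C (4 * k) * .X ^ 3 + .C (3 * k + 2) * .X ^ 2 + .C (3 - k) * .X + 1) * (.X + 1) ^ 3) *
    (.C n * .X + 1) ^ D

theorem coeff_linear_pow (n : ℚ) (D j : ℕ) :
    ((Polynomial.C n * .X + 1) ^ D : Polynomial ℚ).coeff j = n ^ j * D.choose j := by
  have : (Polynomial.C n * .X + 1 : Polynomial ℚ) ^ D =
      (((Polynomial.X + 1) ^ D : Polynomial ℚ).comp (.C n * .X)) := by simp
  rw [this, Polynomial.comp_C_mul_X_coeff, Polynomial.coeff_X_add_one_pow, mul_comm]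

/-- The coefficient of `t ^ (j - i)` in `(n t + 1) ^ D`, or `0` when `j < i`. -/
def shiftedCoeff (n : ℚ) (D j i : ℕ) : ℚ :=
  if i ≤ j then n ^ (j - i) * D.choose (j - i) else 0

theorem coeff_ehrhartPoly (k n : ℚ) (D j : ℕ) :
    (ehrhartPoly k n D).coeff j =
      shiftedCoeff n D j 0 + (6 - k) * shiftedCoeff n D j 1 + 14 * shiftedCoeff n D j 2
      + (10 * k + 16) * shiftedCoeff n D j 3 + (20 * k + 9) * shiftedCoeff n D j 4
      + (15 * k + 2) * shiftedCoeff n D j 5 + 4 * k * shiftedCoeff n D j 6 := by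
  have hshift (i : ℕ) : shiftedCoeff n D j i =
      (Polynomial.X ^ i * (Polynomial.C n * .X + 1) ^ D : Polynomial ℚ).coeff j := by
    rw [Polynomial.coeff_X_pow_mul', coeff_linear_pow, shiftedCoeff]
  simp only [hshift, ← Polynomial.coeff_C_mul, ← Polynomial.coeff_add]
  congr 1
  simp only [ehrhartPoly, map_add, map_sub, map_mul, map_ofNat]
  ring

theorem shiftedCoeff_nonneg {n : ℚ} (hn : 0 ≤ n) (D j i : ℕ) : 0 ≤ shiftedCoeff n D j i := by
  unfold shiftedCoeff
  split_ifs <;> positivity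

theorem shiftedCoeff_add_self_pos {n : ℚ} (hn : 0 < n) (D i : ℕ) :
    0 < shiftedCoeff n D (D + i) i := by
  simp only [shiftedCoeff, Nat.le_add_left, if_true, Nat.add_sub_cancel, Nat.choose_self]
  positivity

theorem shiftedCoeff_of_add_lt (n : ℚ) {D j i : ℕ} (h : D + i < j) : shiftedCoeff n D j i = 0 := by
  rw [shiftedCoeff, if_pos (by omega), Nat.choose_eq_zero_of_lt (by omega)]
  simp

theorem ten_mul_shiftedCoeff_succ_le {D j i : ℕ} (hi : 1 ≤ i) (hj : j ≤ D + 1) :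
    10 * shiftedCoeff (10 * D) D j (i + 1) ≤ shiftedCoeff (10 * D) D j i := by
  unfold shiftedCoeff
  split_ifs with h1 h2
  · obtain ⟨l, rfl⟩ : ∃ l, j = l + (i + 1) := ⟨j - (i + 1), by omega⟩
    rw [show l + (i + 1) - i = l + 1 by omega, Nat.add_sub_cancel]
    have hc : D.choose l ≤ D * D.choose (l + 1) := by
      have := Nat.choose_succ_right_eq D l
      have h3 : 1 ≤ D - l := by omega
      calc D.choose l ≤ D.choose l * (D - l) := Nat.le_mul_of_pos_right _ h3
        _ = D.choose (l + 1) * (l + 1) := this.symm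
        _ ≤ D.choose (l + 1) * D := Nat.mul_le_mul_left _ (by omega)
        _ = _ := mul_comm _ _
    have hc' : (D.choose l : ℚ) ≤ D * D.choose (l + 1) := mod_cast hc
    calc (10 : ℚ) * ((10 * D) ^ l * D.choose l)
        ≤ 10 * ((10 * D) ^ l * (D * D.choose (l + 1))) := by gcongr
      _ = _ := by ring
  · omega
  · rw [mul_zero]
    positivity
  · simp

theorem shiftedCoeff_zero_le {D j : ℕ} (hj : 1 ≤ j) :
    shiftedCoeff (10 * D) D j 0 ≤ 10 * D ^ 2 * shiftedCoeff (10 * D) D j 1 := by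
  obtain ⟨l, rfl⟩ : ∃ l, j = l + 1 := ⟨j - 1, by omega⟩
  simp only [shiftedCoeff, if_true, Nat.le_add_left, Nat.add_sub_cancel, Nat.sub_zero]
  have hc : D.choose (l + 1) ≤ D * D.choose l := by
    calc D.choose (l + 1) ≤ D.choose (l + 1) * (l + 1) := Nat.le_mul_of_pos_right _ l.succ_pos
      _ = D.choose l * (D - l) := Nat.choose_succ_right_eq D l
      _ ≤ D.choose l * D := Nat.mul_le_mul_left _ (Nat.sub_le _ _)
      _ = _ := mul_comm _ _
  have hc' : (D.choose (l + 1) : ℚ) ≤ D * D.choose l := mod_cast hc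
  calc (10 * D : ℚ) ^ (l + 1) * D.choose (l + 1)
      ≤ (10 * D) ^ (l + 1) * (D * D.choose l) := by gcongr
    _ = _ := by ring

theorem coeff_ehrhartPoly_neg {D j : ℕ} (hD : 2 ≤ D) (hj : 1 ≤ j) (hjD : j ≤ D + 1) :
    (ehrhartPoly (20 * D ^ 2) (10 * D) D).coeff j < 0 := by
  rw [coeff_ehrhartPoly]
  have hD' : (2 : ℚ) ≤ D := mod_cast hD
  have h1 : 0 < shiftedCoeff (10 * D) D j 1 := by
    rw [shiftedCoeff, if_pos hj]
    have : 0 < D.choose (j - 1) := Nat.choose_pos (by omega)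
    positivity
  have h0 := shiftedCoeff_zero_le (D := D) hj
  have h2 := ten_mul_shiftedCoeff_succ_le (i := 1) le_rfl hjD
  have h3 := ten_mul_shiftedCoeff_succ_le (i := 2) (by norm_num) hjD
  have h4 := ten_mul_shiftedCoeff_succ_le (i := 3) (by norm_num) hjD
  have h5 := ten_mul_shiftedCoeff_succ_le (i := 4) (by norm_num) hjD
  have h6 := ten_mul_shiftedCoeff_succ_le (i := 5) (by norm_num) hjD
  norm_num only at h2 h3 h4 h5 h6
  set s := shiftedCoeff (10 * D) D j
  have hq : (4 : ℚ) ≤ (D : ℚ) ^ 2 := by nlinarith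
  set q : ℚ := (D : ℚ) ^ 2
  have e3 : (10 * (20 * q) + 16) * s 3 ≤ (10 * (20 * q) + 16) * (s 1 / 100) := by
    gcongr; linarith
  have e4 : (20 * (20 * q) + 9) * s 4 ≤ (20 * (20 * q) + 9) * (s 1 / 1000) := by
    gcongr; linarith
  have e5 : (15 * (20 * q) + 2) * s 5 ≤ (15 * (20 * q) + 2) * (s 1 / 10000) := by
    gcongr; linarith
  have e6 : 4 * (20 * q) * s 6 ≤ 4 * (20 * q) * (s 1 / 100000) := by
    gcongr; linarith
  nlinarith [mul_le_mul_of_nonneg_right hq h1.le]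

theorem coeff_ehrhartPoly_pos {k n : ℚ} (hk : 0 < k) (hn : 0 < n) {D i : ℕ} (hi : 2 ≤ i)
    (hi' : i ≤ 6) : 0 < (ehrhartPoly k n D).coeff (D + i) := by
  rw [coeff_ehrhartPoly, shiftedCoeff_of_add_lt n (show D + 0 < D + i by omega),
    shiftedCoeff_of_add_lt n (show D + 1 < D + i by omega), mul_zero, zero_add, zero_add]
  have hpos := shiftedCoeff_add_self_pos hn D i
  have h := shiftedCoeff_nonneg hn.le D (D + i)
  have h2 := h 2
  have h3 := h 3
  have h4 := h 4
  have h5 := h 5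
  have h6 := h 6
  interval_cases i <;> positivity

theorem natDegree_ehrhartPoly {k n : ℚ} (hk : 0 < k) (hn : 0 < n) (D : ℕ) :
    (ehrhartPoly k n D).natDegree = D + 6 := by
  apply le_antisymm
  · rw [Polynomial.natDegree_le_iff_coeff_eq_zero]
    intro j hj
    rw [coeff_ehrhartPoly]
    simp only [shiftedCoeff_of_add_lt n (show D + 0 < j by omega),
      shiftedCoeff_of_add_lt n (show D + 1 < j by omega),
      shiftedCoeff_of_add_lt n (show D + 2 < j by omega),
      shiftedCoeff_of_add_lt n (show D + 3 < j by omega),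
      shiftedCoeff_of_add_lt n (show D + 4 < j by omega),
      shiftedCoeff_of_add_lt n (show D + 5 < j by omega),
      shiftedCoeff_of_add_lt n (show D + 6 < j by omega)]
    ring
  · exact Polynomial.le_natDegree_of_ne_zero
      (coeff_ehrhartPoly_pos hk hn (by norm_num) le_rfl).ne'

theorem latticeCount_eq_eval_ehrhartPoly (k n D : ℕ) {t : ℕ} (ht : 0 < t) :
    (latticeCount (boxCayley (e := D + 5)
      (Fin.cons 4 (Fin.cons 0 (Fin.cons 1 (Fin.cons 1 (Fin.cons 1 fun _ => n)))))
      (Fin.cons 0 (Fin.cons (6 * k) (Fin.cons 1 (Fin.cons 1 (Fin.cons 1 fun _ => n)))))) t : ℚ) =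
      (ehrhartPoly k n D).eval (t : ℚ) := by
  rw [latticeCount_boxCayley _ _ ht]
  simp only [Fin.prod_univ_succ, Fin.cons_zero, Fin.cons_succ, Finset.prod_const,
    Finset.card_univ, Fintype.card_fin]
  have hterm : ∀ y ∈ Finset.range (t + 1),
      (((4 * (t - y) + 0 * y + 1) * ((0 * (t - y) + 6 * k * y + 1) *
        ((1 * (t - y) + 1 * y + 1) * ((1 * (t - y) + 1 * y + 1) * ((1 * (t - y) + 1 * y + 1) *
          (n * (t - y) + n * y + 1) ^ D)))) : ℕ) : ℚ) =
      (4 * ((t : ℚ) - y) + 1) * (6 * k * y + 1) * ((t + 1) ^ 3 * (n * t + 1) ^ D) := by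
    intro y hy
    obtain ⟨s, rfl⟩ := Nat.exists_eq_add_of_le (Nat.lt_succ_iff.1 (Finset.mem_range.1 hy))
    rw [Nat.add_sub_cancel_left]
    push_cast
    rw [show (n * s + n * y + 1 : ℚ) = n * (y + s) + 1 by ring]
    ring
  rw [Nat.cast_sum, Finset.sum_congr rfl hterm, ← Finset.sum_mul, sum_range_mul_linear]
  simp only [ehrhartPoly, Polynomial.eval_mul, Polynomial.eval_add, Polynomial.eval_pow,
    Polynomial.eval_C, Polynomial.eval_X, Polynomial.eval_one]
  ring

theorem three_positive (d : ℕ) (hd : 12 ≤ d) :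
    ∃ (P : Set (Fin d → ℝ)) (p : Polynomial ℚ),
      IsIntegralPolytope P ∧ affineSpan ℝ P = ⊤ ∧
      p.natDegree = d ∧ p.coeff 0 = 1 ∧
      (∀ t : ℕ, 0 < t → (latticeCount P t : ℚ) = p.eval (t : ℚ)) ∧
      0 < p.coeff (d - 2) ∧ 0 < p.coeff (d - 3) ∧ 0 < p.coeff (d - 4) ∧
      (∀ j : ℕ, 1 ≤ j → j < d - 4 → p.coeff j < 0) := by
  obtain ⟨D, rfl⟩ : ∃ D, d = D + 6 := ⟨d - 6, by omega⟩
  have hD : (0 : ℚ) < D := by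
    have : 0 < D := by omega
    exact_mod_cast this
  have hk : (0 : ℚ) < 20 * D ^ 2 := by positivity
  have hn : (0 : ℚ) < 10 * D := by positivity
  refine ⟨boxCayley (e := D + 5)
    (Fin.cons 4 (Fin.cons 0 (Fin.cons 1 (Fin.cons 1 (Fin.cons 1 fun _ => 10 * D)))))
    (Fin.cons 0 (Fin.cons (6 * (20 * D ^ 2))
      (Fin.cons 1 (Fin.cons 1 (Fin.cons 1 fun _ => 10 * D))))),
    ehrhartPoly (20 * D ^ 2) (10 * D) D, isIntegralPolytope_boxCayley _ _,
    affineSpan_boxCayley _ _ ?_, natDegree_ehrhartPoly hk hn D, ?_, fun t ht => ?_,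
    coeff_ehrhartPoly_pos hk hn (i := 4) (by norm_num) (by norm_num),
    coeff_ehrhartPoly_pos hk hn (i := 3) (by norm_num) (by norm_num),
    coeff_ehrhartPoly_pos hk hn (i := 2) (by norm_num) (by norm_num),
    fun j hj hj' => coeff_ehrhartPoly_neg (by omega) hj (by omega)⟩
  · have hD' : 0 < D := by omega
    simp only [Fin.forall_fin_succ, Fin.cons_zero, Fin.cons_succ]
    refine ⟨by norm_num, by positivity, by norm_num, by norm_num, by norm_num,
      fun _ => by positivity⟩
  · simp [coeff_ehrhartPoly, shiftedCoeff]
  · rw [latticeCount_eq_eval_ehrhartPoly _ _ _ ht]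
    push_cast
    rfl
end
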